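/- Let y_F be the linear chain with nearest-neighbor spacing Fε. Suppose φ'(2F) ≥ 0, φ''(2F) ≤ 0, and γ₄ := min{ φ''(F) + 4 φ''(2F), φ'(F)/F } > 0. Given f ∈ 𝒰, let u^a, u^QNL ∈ 𝒰 satisfy δE^a(y_F)[v] + δ²E^a(y_F)[u^a, v] = ⟨f, v⟩ and δE^QNL(y_F)[v] + δ²E^QNL(y_F)[u^QNL, v] = ⟨f, v⟩, respectively, for all v ∈ 𝒰. Then ‖(u^a − u^QNL)'‖_{ℓ²_ε} ≤ (max{ |φ''(2F)|, |φ'(2F)/(2F)| } / γ₄) · ε · [ ( ε‖(u^a)''_1‖² + ε‖(u^a)''_{K+2}‖² )^{1/2} + ε ( ε Σ_{ℓ=K+2}^N ‖(u^a)'''_{ℓ+1}‖² )^{1/2} ]. -/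

import Mathlib

noncomputable section

open Real Finset

/-- Euclidean norm on `ℝ × ℝ`. -/
def enorm2 (v : ℝ × ℝ) : ℝ := Real.sqrt (v.1 ^ 2 + v.2 ^ 2)

/-- Euclidean dot product on `ℝ × ℝ`. -/
def edot (v w : ℝ × ℝ) : ℝ := v.1 * w.1 + v.2 * w.2

/-- `N`-periodic mean-zero displacements (the space `𝒰`). -/
def IsDisp (N : ℕ) (u : ℤ → ℝ × ℝ) : Prop :=
  (∀ ℓ : ℤ, u (ℓ + (N : ℤ)) = u ℓ) ∧ ∑ ℓ ∈ Finset.Icc (1 : ℤ) (N : ℤ), u ℓ = 0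

/-- Constrained displacements (the space `𝒰̃`): second component vanishes. -/
def IsDisp1D (N : ℕ) (u : ℤ → ℝ × ℝ) : Prop :=
  IsDisp N u ∧ ∀ ℓ : ℤ, (u ℓ).2 = 0

/-- Backward difference `u'_ℓ = (u_ℓ - u_{ℓ-1})/ε`. -/
def bd (ε : ℝ) (u : ℤ → ℝ × ℝ) (ℓ : ℤ) : ℝ × ℝ := ε⁻¹ • (u ℓ - u (ℓ - 1))

/-- The inner product `⟨v,w⟩ = ε ∑_{ℓ=1}^N v_ℓ · w_ℓ`. -/
def ip (N : ℕ) (ε : ℝ) (v w : ℤ → ℝ × ℝ) : ℝ :=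
  ε * ∑ ℓ ∈ Finset.Icc (1 : ℤ) (N : ℤ), edot (v ℓ) (w ℓ)

/-- The norm `‖v‖_{ℓ²_ε}`. -/
def nrm (N : ℕ) (ε : ℝ) (v : ℤ → ℝ × ℝ) : ℝ :=
  Real.sqrt (ε * ∑ ℓ ∈ Finset.Icc (1 : ℤ) (N : ℤ), (enorm2 (v ℓ)) ^ 2)

/-- The atomistic energy `E^a`. -/
def Ea (N : ℕ) (ε : ℝ) (φ : ℝ → ℝ) (y : ℤ → ℝ × ℝ) : ℝ :=
  ε * ∑ ℓ ∈ Finset.Icc (1 : ℤ) (N : ℤ),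
    (φ (enorm2 (bd ε y ℓ)) + φ (enorm2 (bd ε y (ℓ + 1) + bd ε y ℓ)))

/-- The Cauchy–Born energy `E^CB`. -/
def ECB (N : ℕ) (ε : ℝ) (φ : ℝ → ℝ) (y : ℤ → ℝ × ℝ) : ℝ :=
  ε * ∑ ℓ ∈ Finset.Icc (1 : ℤ) (N : ℤ),
    (φ (enorm2 (bd ε y ℓ)) + φ (2 * enorm2 (bd ε y ℓ)))

/-- The bond-angle energy `E^b`. -/
def Eb (N : ℕ) (ε α : ℝ) (y : ℤ → ℝ × ℝ) : ℝ :=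
  ε * ∑ ℓ ∈ Finset.Icc (1 : ℤ) (N : ℤ),
    α * (1 - edot (bd ε y (ℓ + 1)) (bd ε y ℓ) /
      (enorm2 (bd ε y (ℓ + 1)) * enorm2 (bd ε y ℓ)))

/-- The quasi-nonlocal energy `E^QNL`. -/
def EQNL (N K : ℕ) (ε : ℝ) (φ : ℝ → ℝ) (y : ℤ → ℝ × ℝ) : ℝ :=
  ε * ∑ ℓ ∈ Finset.Icc (1 : ℤ) (N : ℤ), φ (enorm2 (bd ε y ℓ))
  + ε * ∑ ℓ ∈ Finset.Icc (1 : ℤ) (K : ℤ), φ (enorm2 (bd ε y (ℓ + 1) + bd ε y ℓ))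
  + ε * ∑ ℓ ∈ Finset.Icc ((K : ℤ) + 2) (N : ℤ), φ (2 * enorm2 (bd ε y ℓ))
  + ε / 2 * φ (2 * enorm2 (bd ε y 1)) + ε / 2 * φ (2 * enorm2 (bd ε y ((K : ℤ) + 1)))

/-- First variation `δE(y)[u] = (d/dt) E(y + t u) |_{t=0}`. -/
def dE (E : (ℤ → ℝ × ℝ) → ℝ) (y u : ℤ → ℝ × ℝ) : ℝ :=
  deriv (fun t : ℝ => E (fun ℓ => y ℓ + t • u ℓ)) 0

/-- Second variation `δ²E(y)[u,v] = (∂²/∂t∂s) E(y + t u + s v) |_{t=s=0}`. -/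
def d2E (E : (ℤ → ℝ × ℝ) → ℝ) (y u v : ℤ → ℝ × ℝ) : ℝ :=
  deriv (fun s : ℝ => deriv (fun t : ℝ => E (fun ℓ => y ℓ + t • u ℓ + s • v ℓ)) 0) 0

/-- The linear chain `y_{F,ℓ} = (Fεℓ, 0)`. -/
def yLin (ε F : ℝ) : ℤ → ℝ × ℝ := fun ℓ => (F * ε * ℓ, 0)

/-- The uniform circular chain of radius `R = Fε/(2 sin(πε))`. -/
def yCirc (ε F : ℝ) : ℤ → ℝ × ℝ := fun ℓ =>
  (F * ε / (2 * Real.sin (π * ε)) * Real.cos (2 * π * ε * ℓ),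
   F * ε / (2 * Real.sin (π * ε)) * Real.sin (2 * π * ε * ℓ))

/-- two-parameter function with mixed derivative `d` at the origin -/
def Var2 (h : ℝ → ℝ → ℝ) (d : ℝ) : Prop :=
  ∃ D : ℝ → ℝ, (∀ᶠ s in nhds (0 : ℝ), HasDerivAt (fun t => h t s) (D s) 0) ∧ HasDerivAt D d 0

theorem Var2.deriv_eq {h : ℝ → ℝ → ℝ} {d : ℝ} (H : Var2 h d) :
    deriv (fun s : ℝ => deriv (fun t : ℝ => h t s) 0) 0 = d := by
  obtain ⟨D, h1, h2⟩ := H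
  have : (fun s : ℝ => deriv (fun t : ℝ => h t s) 0) =ᶠ[nhds 0] D := by
    filter_upwards [h1] with s hs using hs.deriv
  rw [this.deriv_eq, h2.deriv]

theorem Var2.add {h k : ℝ → ℝ → ℝ} {d e : ℝ} (H : Var2 h d) (G : Var2 k e) :
    Var2 (fun t s => h t s + k t s) (d + e) := by
  obtain ⟨D, h1, h2⟩ := H
  obtain ⟨D', k1, k2⟩ := G
  refine ⟨fun s => D s + D' s, ?_, h2.add k2⟩
  filter_upwards [h1, k1] with s hs ks using hs.add ks

theorem Var2.cmul {h : ℝ → ℝ → ℝ} {d : ℝ} (c : ℝ) (H : Var2 h d) :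
    Var2 (fun t s => c * h t s) (c * d) := by
  obtain ⟨D, h1, h2⟩ := H
  refine ⟨fun s => c * D s, ?_, h2.const_mul c⟩
  filter_upwards [h1] with s hs using hs.const_mul c

theorem Var2.sum {h : ℤ → ℝ → ℝ → ℝ} {d : ℤ → ℝ} (S : Finset ℤ) (H : ∀ i, Var2 (h i) (d i)) :
    Var2 (fun t s => ∑ i ∈ S, h i t s) (∑ i ∈ S, d i) := by
  choose D h1 h2 using H
  refine ⟨fun s => ∑ i ∈ S, D i s, ?_, HasDerivAt.fun_sum fun i _ => h2 i⟩
  have : ∀ᶠ s in nhds (0 : ℝ), ∀ i ∈ S, HasDerivAt (fun t => h i t s) (D i s) 0 :=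
    (Filter.eventually_all_finset S).2 fun i _ => h1 i
  filter_upwards [this] with s hs using HasDerivAt.fun_sum fun i hi => hs i hi

theorem enorm2_pos_of_fst {v : ℝ × ℝ} (h : 0 < v.1) : 0 < enorm2 v := by
  unfold enorm2
  positivity

theorem hasDerivAt_enorm2 (p a : ℝ × ℝ) (hp : 0 < p.1) :
    HasDerivAt (fun t : ℝ => enorm2 (p + t • a)) (edot p a / enorm2 p) 0 := by
  unfold enorm2 edot
  have h1 : HasDerivAt (fun t : ℝ => (p + t • a).1 ^ 2 + (p + t • a).2 ^ 2)
      (2 * (p.1 * a.1 + p.2 * a.2)) 0 := by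
    have e1 : HasDerivAt (fun t : ℝ => p.1 + t * a.1) a.1 0 := by
      simpa using ((hasDerivAt_id (0:ℝ)).mul_const a.1).const_add p.1
    have e2 : HasDerivAt (fun t : ℝ => p.2 + t * a.2) a.2 0 := by
      simpa using ((hasDerivAt_id (0:ℝ)).mul_const a.2).const_add p.2
    refine ((e1.pow 2).add (e2.pow 2)).congr_deriv ?_
    simp; ring
  have h2 : (p + (0:ℝ) • a).1 ^ 2 + (p + (0:ℝ) • a).2 ^ 2 ≠ 0 := by
    simp; positivity
  refine (h1.sqrt h2).congr_deriv ?_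
  simp
  rw [mul_div_mul_left _ _ (by norm_num)]

theorem phi_facts {φ : ℝ → ℝ} (hφ : ContDiffOn ℝ 2 φ (Set.Ioi 0)) {x : ℝ} (hx : 0 < x) :
    HasDerivAt φ (deriv φ x) x ∧ HasDerivAt (deriv φ) (deriv (deriv φ) x) x := by
  have hn : Set.Ioi (0:ℝ) ∈ nhds x := Ioi_mem_nhds hx
  constructor
  · exact ((hφ.differentiableOn (by norm_num)).differentiableAt hn).hasDerivAt
  · have h2 : ContDiffOn ℝ (1 + 1) φ (Set.Ioi 0) := by
      convert hφ using 1; norm_num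
    have := ((contDiffOn_succ_iff_deriv_of_isOpen isOpen_Ioi).1 h2).2.2
    exact ((this.differentiableOn (by norm_num)).differentiableAt hn).hasDerivAt

theorem bond_deriv {φ : ℝ → ℝ} (hφ : ContDiffOn ℝ 2 φ (Set.Ioi 0)) (p a : ℝ × ℝ) (hp : 0 < p.1)
    (c : ℝ) (hc : 0 < c) :
    HasDerivAt (fun t : ℝ => φ (c * enorm2 (p + t • a)))
      (deriv φ (c * enorm2 p) * (c * (edot p a / enorm2 p))) 0 := by
  have h1 := (hasDerivAt_enorm2 p a hp).const_mul c
  have h2 := (phi_facts hφ (mul_pos hc (enorm2_pos_of_fst hp))).1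
  have h3 : HasDerivAt φ (deriv φ (c * enorm2 p)) (c * enorm2 (p + (0:ℝ) • a)) := by simpa using h2
  exact h3.comp (0:ℝ) h1

theorem enorm2_lin {G : ℝ} (hG : 0 < G) : enorm2 (G, 0) = G := by
  simp [enorm2, Real.sqrt_sq hG.le]

theorem bond_var2 {φ : ℝ → ℝ} (hφ : ContDiffOn ℝ 2 φ (Set.Ioi 0)) (G : ℝ) (hG : 0 < G)
    (a b : ℝ × ℝ) (c : ℝ) (hc : 0 < c) :
    Var2 (fun t s : ℝ => φ (c * enorm2 ((G, 0) + t • a + s • b)))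
      (c ^ 2 * deriv (deriv φ) (c * G) * a.1 * b.1 + c * deriv φ (c * G) / G * a.2 * b.2) := by
  refine ⟨fun s => deriv φ (c * enorm2 ((G, 0) + s • b)) *
    (c * (edot ((G, 0) + s • b) a / enorm2 ((G, 0) + s • b))), ?_, ?_⟩
  · have hcont : Continuous fun s : ℝ => G + s * b.1 := by fun_prop
    have : ∀ᶠ s in nhds (0:ℝ), 0 < G + s * b.1 :=
      hcont.continuousAt.eventually (Ioi_mem_nhds (by simpa using hG))
    filter_upwards [this] with s hs
    have := bond_deriv hφ ((G, 0) + s • b) a (by simpa using hs) c hc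
    simpa [add_right_comm] using this
  · have h1 := hasDerivAt_enorm2 (G, 0) b hG
    rw [enorm2_lin hG] at h1
    have e0 : enorm2 ((G, 0) + (0:ℝ) • b) = G := by simp [enorm2_lin hG]
    have h2 := (phi_facts hφ (mul_pos hc hG)).2
    rw [← e0] at h2
    have h3 := h2.comp (0:ℝ) (h1.const_mul c)
    have h4 : HasDerivAt (fun s : ℝ => edot ((G, 0) + s • b) a) (edot b a) 0 := by
      have e1 : HasDerivAt (fun t : ℝ => (G + t * b.1) * a.1) (b.1 * a.1) 0 := by
        simpa using (((hasDerivAt_id (0:ℝ)).mul_const b.1).const_add G).mul_const a.1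
      have e2 : HasDerivAt (fun t : ℝ => (t * b.2) * a.2) (b.2 * a.2) 0 := by
        simpa using ((hasDerivAt_id (0:ℝ)).mul_const b.2).mul_const a.2
      have := e1.add e2
      have e3 : (fun s : ℝ => edot ((G, 0) + s • b) a) =
          ((fun t => (G + t * b.1) * a.1) + fun t => t * b.2 * a.2) := by
        ext t; simp [edot]
      rw [e3]
      exact this
    have h5 := h3.mul ((h4.div h1 (by rw [e0]; exact hG.ne')).const_mul c)
    refine h5.congr_deriv ?_
    simp only [Function.comp, e0, Pi.div_apply]
    simp [edot]
    field_simp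
    ring

theorem bd_lin1 {ε F : ℝ} (hε : ε ≠ 0) (u : ℤ → ℝ × ℝ) (t : ℝ) (l : ℤ) :
    bd ε (fun ℓ => yLin ε F ℓ + t • u ℓ) l = (F, 0) + t • bd ε u l := by
  unfold bd yLin
  ext
  · simp; field_simp; ring
  · simp; ring

theorem bd_lin1s {ε F : ℝ} (hε : ε ≠ 0) (u : ℤ → ℝ × ℝ) (t : ℝ) (l : ℤ) :
    bd ε (fun ℓ => yLin ε F ℓ + t • u ℓ) (l + 1) + bd ε (fun ℓ => yLin ε F ℓ + t • u ℓ) l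
      = (2 * F, 0) + t • (bd ε u (l + 1) + bd ε u l) := by
  rw [bd_lin1 hε, bd_lin1 hε]
  ext
  · simp; ring
  · simp

theorem bd_lin2 {ε F : ℝ} (hε : ε ≠ 0) (u v : ℤ → ℝ × ℝ) (t s : ℝ) (l : ℤ) :
    bd ε (fun ℓ => yLin ε F ℓ + t • u ℓ + s • v ℓ) l = (F, 0) + t • bd ε u l + s • bd ε v l := by
  unfold bd yLin
  ext
  · simp; field_simp; ring
  · simp; ring

theorem bd_lin2s {ε F : ℝ} (hε : ε ≠ 0) (u v : ℤ → ℝ × ℝ) (t s : ℝ) (l : ℤ) :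
    bd ε (fun ℓ => yLin ε F ℓ + t • u ℓ + s • v ℓ) (l + 1)
      + bd ε (fun ℓ => yLin ε F ℓ + t • u ℓ + s • v ℓ) l
      = (2 * F, 0) + t • (bd ε u (l + 1) + bd ε u l) + s • (bd ε v (l + 1) + bd ε v l) := by
  rw [bd_lin2 hε, bd_lin2 hε]
  ext
  · simp; ring
  · simp; ring

theorem bond1 {φ : ℝ → ℝ} (hφ : ContDiffOn ℝ 2 φ (Set.Ioi 0)) (G : ℝ) (hG : 0 < G) (a : ℝ × ℝ) :
    HasDerivAt (fun t : ℝ => φ (enorm2 ((G, 0) + t • a))) (deriv φ G * a.1) 0 := by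
  have := bond_deriv hφ (G, 0) a hG 1 one_pos
  rw [enorm2_lin hG] at this
  simp only [one_mul] at this
  refine this.congr_deriv ?_
  simp [edot]; field_simp; simp

theorem bond1' {φ : ℝ → ℝ} (hφ : ContDiffOn ℝ 2 φ (Set.Ioi 0)) (G : ℝ) (hG : 0 < G) (a : ℝ × ℝ) :
    HasDerivAt (fun t : ℝ => φ (2 * enorm2 ((G, 0) + t • a))) (deriv φ (2 * G) * (2 * a.1)) 0 := by
  have := bond_deriv hφ (G, 0) a hG 2 two_pos
  rw [enorm2_lin hG] at this
  refine this.congr_deriv ?_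
  simp [edot]; field_simp; simp

theorem bond2 {φ : ℝ → ℝ} (hφ : ContDiffOn ℝ 2 φ (Set.Ioi 0)) (G : ℝ) (hG : 0 < G)
    (a b : ℝ × ℝ) :
    Var2 (fun t s : ℝ => φ (enorm2 ((G, 0) + t • a + s • b)))
      (deriv (deriv φ) G * (a.1 * b.1) + deriv φ G / G * (a.2 * b.2)) := by
  have := bond_var2 hφ G hG a b 1 one_pos
  simp only [one_mul, one_pow, mul_assoc] at this
  exact this

theorem bond2' {φ : ℝ → ℝ} (hφ : ContDiffOn ℝ 2 φ (Set.Ioi 0)) (G : ℝ) (hG : 0 < G)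
    (a b : ℝ × ℝ) :
    Var2 (fun t s : ℝ => φ (2 * enorm2 ((G, 0) + t • a + s • b)))
      (deriv (deriv φ) (2 * G) * (4 * (a.1 * b.1))
        + deriv φ (2 * G) / (2 * G) * (4 * (a.2 * b.2))) := by
  have := bond_var2 hφ G hG a b 2 two_pos
  convert this using 1
  field_simp
  ring

/-- scalar quadratic forms -/
def Sa (N : ℕ) (A B : ℝ) (p q : ℤ → ℝ) : ℝ :=
  ∑ l ∈ Finset.Icc (1 : ℤ) (N : ℤ), (A * (p l * q l)
    + B * ((p (l + 1) + p l) * (q (l + 1) + q l)))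

/-- scalar quadratic form of the quasi-nonlocal energy -/
def SQ (N K : ℕ) (A B : ℝ) (p q : ℤ → ℝ) : ℝ :=
  ∑ l ∈ Finset.Icc (1 : ℤ) (N : ℤ), A * (p l * q l)
  + ∑ l ∈ Finset.Icc (1 : ℤ) (K : ℤ), B * ((p (l + 1) + p l) * (q (l + 1) + q l))
  + ∑ l ∈ Finset.Icc ((K : ℤ) + 2) (N : ℤ), B * (4 * (p l * q l))
  + 2 * B * (p 1 * q 1) + 2 * B * (p ((K : ℤ) + 1) * q ((K : ℤ) + 1))

theorem dEa_eq (N : ℕ) {ε : ℝ} (hε : ε ≠ 0) {φ : ℝ → ℝ} (hφ : ContDiffOn ℝ 2 φ (Set.Ioi 0))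
    {F : ℝ} (hF : 0 < F) (v : ℤ → ℝ × ℝ) :
    dE (Ea N ε φ) (yLin ε F) v = ε * ∑ l ∈ Finset.Icc (1 : ℤ) (N : ℤ),
      (deriv φ F * (bd ε v l).1 + deriv φ (2 * F) * (bd ε v (l + 1) + bd ε v l).1) := by
  unfold dE Ea
  simp only [bd_lin1s hε]
  simp only [bd_lin1 hε]
  refine HasDerivAt.deriv ?_
  refine HasDerivAt.const_mul _ (HasDerivAt.fun_sum fun l _ => ?_)
  exact (bond1 hφ F hF _).add (bond1 hφ (2 * F) (by positivity) _)

theorem d2Ea_eq (N : ℕ) {ε : ℝ} (hε : ε ≠ 0) {φ : ℝ → ℝ} (hφ : ContDiffOn ℝ 2 φ (Set.Ioi 0))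
    {F : ℝ} (hF : 0 < F) (u v : ℤ → ℝ × ℝ) :
    d2E (Ea N ε φ) (yLin ε F) u v =
      ε * (Sa N (deriv (deriv φ) F) (deriv (deriv φ) (2 * F))
            (fun l => (bd ε u l).1) (fun l => (bd ε v l).1)
        + Sa N (deriv φ F / F) (deriv φ (2 * F) / (2 * F))
            (fun l => (bd ε u l).2) (fun l => (bd ε v l).2)) := by
  unfold d2E Ea
  simp only [bd_lin2s hε]
  simp only [bd_lin2 hε]
  have := Var2.cmul ε (Var2.sum (Finset.Icc (1 : ℤ) (N : ℤ)) fun l =>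
    (bond2 hφ F hF (bd ε u l) (bd ε v l)).add
    (bond2 hφ (2 * F) (by positivity) (bd ε u (l + 1) + bd ε u l) (bd ε v (l + 1) + bd ε v l)))
  rw [this.deriv_eq, Sa, Sa, ← Finset.sum_add_distrib]
  congr 1
  refine Finset.sum_congr rfl fun l _ => ?_
  simp only [Prod.fst_add, Prod.snd_add]
  ring

theorem dEQ_eq (N K : ℕ) {ε : ℝ} (hε : ε ≠ 0) {φ : ℝ → ℝ} (hφ : ContDiffOn ℝ 2 φ (Set.Ioi 0))
    {F : ℝ} (hF : 0 < F) (v : ℤ → ℝ × ℝ) :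
    dE (EQNL N K ε φ) (yLin ε F) v =
      ε * ∑ l ∈ Finset.Icc (1 : ℤ) (N : ℤ), deriv φ F * (bd ε v l).1
      + ε * ∑ l ∈ Finset.Icc (1 : ℤ) (K : ℤ), deriv φ (2 * F) * (bd ε v (l + 1) + bd ε v l).1
      + ε * ∑ l ∈ Finset.Icc ((K : ℤ) + 2) (N : ℤ), deriv φ (2 * F) * (2 * (bd ε v l).1)
      + ε / 2 * (deriv φ (2 * F) * (2 * (bd ε v 1).1))
      + ε / 2 * (deriv φ (2 * F) * (2 * (bd ε v ((K : ℤ) + 1)).1)) := by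
  unfold dE EQNL
  simp only [bd_lin1s hε]
  simp only [bd_lin1 hε]
  refine HasDerivAt.deriv ?_
  refine ((((HasDerivAt.const_mul _ (HasDerivAt.fun_sum fun l _ => ?_)).add
    (HasDerivAt.const_mul _ (HasDerivAt.fun_sum fun l _ => ?_))).add
    (HasDerivAt.const_mul _ (HasDerivAt.fun_sum fun l _ => ?_))).add
    (HasDerivAt.const_mul _ ?_)).add (HasDerivAt.const_mul _ ?_)
  · exact bond1 hφ F hF _
  · exact bond1 hφ (2 * F) (by positivity) _
  · exact bond1' hφ F hF _
  · exact bond1' hφ F hF _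
  · exact bond1' hφ F hF _

theorem d2EQ_eq (N K : ℕ) {ε : ℝ} (hε : ε ≠ 0) {φ : ℝ → ℝ} (hφ : ContDiffOn ℝ 2 φ (Set.Ioi 0))
    {F : ℝ} (hF : 0 < F) (u v : ℤ → ℝ × ℝ) :
    d2E (EQNL N K ε φ) (yLin ε F) u v =
      ε * (SQ N K (deriv (deriv φ) F) (deriv (deriv φ) (2 * F))
            (fun l => (bd ε u l).1) (fun l => (bd ε v l).1)
        + SQ N K (deriv φ F / F) (deriv φ (2 * F) / (2 * F))
            (fun l => (bd ε u l).2) (fun l => (bd ε v l).2)) := by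
  unfold d2E EQNL
  simp only [bd_lin2s hε]
  simp only [bd_lin2 hε]
  have h1 := Var2.cmul ε (Var2.sum (Finset.Icc (1 : ℤ) (N : ℤ)) fun l =>
    (bond2 hφ F hF (bd ε u l) (bd ε v l)))
  have h2 := Var2.cmul ε (Var2.sum (Finset.Icc (1 : ℤ) (K : ℤ)) fun l =>
    (bond2 hφ (2 * F) (by positivity) (bd ε u (l + 1) + bd ε u l) (bd ε v (l + 1) + bd ε v l)))
  have h3 := Var2.cmul ε (Var2.sum (Finset.Icc ((K : ℤ) + 2) (N : ℤ)) fun l =>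
    (bond2' hφ F hF (bd ε u l) (bd ε v l)))
  have h4 := Var2.cmul (ε / 2) (bond2' hφ F hF (bd ε u 1) (bd ε v 1))
  have h5 := Var2.cmul (ε / 2) (bond2' hφ F hF (bd ε u ((K : ℤ) + 1)) (bd ε v ((K : ℤ) + 1)))
  rw [((((h1.add h2).add h3).add h4).add h5).deriv_eq, SQ, SQ]
  simp only [Prod.fst_add, Prod.snd_add, Finset.sum_add_distrib]
  ring

theorem telescope (p q : ℤ → ℝ) (k M : ℤ) (h : k + 1 ≤ M) :
    ∑ l ∈ Finset.Icc (k + 1) M, (p (l + 1) + p l) * (q (l + 1) + q l)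
      = ∑ l ∈ Finset.Icc (k + 2) M, (4 * (p l * q l) + (p (l + 1) - 2 * p l + p (l - 1)) * q l)
        + (p (k + 2) + p (k + 1)) * q (k + 1) + (p (M + 1) + p M) * q (M + 1) := by
  induction M, h using Int.leInduction with
  | base =>
    rw [Finset.Icc_self, Finset.sum_singleton, Finset.Icc_eq_empty (by omega)]
    rw [show k + 1 + 1 = k + 2 by ring]
    simp; ring
  | succ M hM ih =>
    have e1 : Finset.Icc (k + 1) (M + 1) = insert (M + 1) (Finset.Icc (k + 1) M) := by
      ext x; simp; omega
    have e2 : Finset.Icc (k + 2) (M + 1) = insert (M + 1) (Finset.Icc (k + 2) M) := by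
      ext x; simp; omega
    rw [e1, e2, Finset.sum_insert (by simp), Finset.sum_insert (by simp), ih,
      show M + 1 - 1 = M by ring]
    ring

theorem sum_split (g : ℤ → ℝ) {K N : ℕ} (h : K + 2 < N) :
    ∑ l ∈ Finset.Icc (1 : ℤ) (N : ℤ), g l = ∑ l ∈ Finset.Icc (1 : ℤ) (K : ℤ), g l
      + ∑ l ∈ Finset.Icc ((K : ℤ) + 1) (N : ℤ), g l := by
  rw [← Finset.sum_union]
  · congr 1; ext x; simp; omega
  · rw [Finset.disjoint_left]; intro x; simp; omega

theorem sum_split' (g : ℤ → ℝ) {K N : ℕ} (h : K + 2 < N) :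
    ∑ l ∈ Finset.Icc ((K : ℤ) + 1) (N : ℤ), g l = g ((K : ℤ) + 1)
      + ∑ l ∈ Finset.Icc ((K : ℤ) + 2) (N : ℤ), g l := by
  rw [← Finset.sum_insert (by simp)]
  congr 1; ext x; simp; omega

theorem sum_shift (g : ℤ → ℝ) (K : ℕ) :
    ∑ l ∈ Finset.Icc (1 : ℤ) (K : ℤ), g (l + 1)
      = ∑ l ∈ Finset.Icc (1 : ℤ) (K : ℤ), g l + g ((K : ℤ) + 1) - g 1 := by
  induction K with
  | zero => simp
  | succ K ih =>
    have e1 : Finset.Icc (1 : ℤ) ((K + 1 : ℕ) : ℤ) = insert ((K : ℤ) + 1) (Finset.Icc 1 (K : ℤ)) := by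
      ext x; simp; omega
    rw [e1, Finset.sum_insert (by simp), Finset.sum_insert (by simp), ih]
    push_cast
    ring

theorem SQ_sub_Sa {N K : ℕ} (h : K + 2 < N) (A B : ℝ) (p q : ℤ → ℝ)
    (hp : ∀ l, p (l + (N : ℤ)) = p l) (hq : ∀ l, q (l + (N : ℤ)) = q l) :
    SQ N K A B p q - Sa N A B p q =
      B * (-∑ l ∈ Finset.Icc ((K : ℤ) + 2) (N : ℤ), (p (l + 1) - 2 * p l + p (l - 1)) * q l
        - (p ((K : ℤ) + 2) - p ((K : ℤ) + 1)) * q ((K : ℤ) + 1) + (p 1 - p 0) * q 1) := by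
  have t := telescope p q K N (by omega)
  have p1 : p ((N : ℤ) + 1) = p 1 := by rw [add_comm]; exact hp 1
  have q1 : q ((N : ℤ) + 1) = q 1 := by rw [add_comm]; exact hq 1
  have p0 : p (N : ℤ) = p 0 := by simpa using hp 0
  rw [Finset.sum_add_distrib, ← Finset.mul_sum, p1, q1, p0] at t
  rw [Sa, SQ, Finset.sum_add_distrib]
  simp only [← Finset.mul_sum]
  rw [sum_split (fun l => (p (l + 1) + p l) * (q (l + 1) + q l)) h, t]
  ring

theorem SQ_lower {N K : ℕ} (h : K + 2 < N) (A B : ℝ) (hB : B ≤ 0) (p : ℤ → ℝ) :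
    (A + 4 * B) * ∑ l ∈ Finset.Icc (1 : ℤ) (N : ℤ), p l ^ 2 ≤ SQ N K A B p p := by
  have h1 : ∑ l ∈ Finset.Icc (1 : ℤ) (K : ℤ), (p (l + 1) + p l) * (p (l + 1) + p l)
      ≤ ∑ l ∈ Finset.Icc (1 : ℤ) (K : ℤ), (2 * p (l + 1) ^ 2 + 2 * p l ^ 2) :=
    Finset.sum_le_sum fun l _ => by nlinarith [sq_nonneg (p (l + 1) - p l)]
  rw [Finset.sum_add_distrib, ← Finset.mul_sum, ← Finset.mul_sum,
    sum_shift (fun l => p l ^ 2)] at h1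
  have h2 := mul_le_mul_of_nonpos_left h1 hB
  rw [SQ]
  simp only [← Finset.mul_sum, ← sq] at h2 ⊢
  have s1 := sum_split (fun l => p l ^ 2) h
  have s2 := sum_split' (fun l => p l ^ 2) h
  rw [s2] at s1
  have s3 := congrArg (fun x => 4 * B * x) s1
  linarith

theorem SQ_lower' {N K : ℕ} (A B : ℝ) (hB : 0 ≤ B) (p : ℤ → ℝ) :
    A * ∑ l ∈ Finset.Icc (1 : ℤ) (N : ℤ), p l ^ 2 ≤ SQ N K A B p p := by
  rw [SQ]
  simp only [← Finset.mul_sum, ← sq]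
  have := Finset.sum_nonneg (s := Finset.Icc (1 : ℤ) (K : ℤ))
    (f := fun l => (p (l + 1) + p l) ^ 2) (fun _ _ => sq_nonneg _)
  have := Finset.sum_nonneg (s := Finset.Icc ((K : ℤ) + 2) (N : ℤ))
    (f := fun l => (p l) ^ 2) (fun _ _ => sq_nonneg _)
  have : 0 ≤ B * ∑ l ∈ Finset.Icc (1 : ℤ) (K : ℤ), (p (l + 1) + p l) ^ 2 := by positivity
  have : 0 ≤ B * (4 * ∑ l ∈ Finset.Icc ((K : ℤ) + 2) (N : ℤ), (p l) ^ 2) := by positivity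
  have : 0 ≤ 2 * B * p 1 ^ 2 := by positivity
  have : 0 ≤ 2 * B * p ((K : ℤ) + 1) ^ 2 := by positivity
  linarith

theorem bd_per {N : ℕ} {ε : ℝ} {u : ℤ → ℝ × ℝ} (h : IsDisp N u) (l : ℤ) :
    bd ε u (l + (N : ℤ)) = bd ε u l := by
  unfold bd
  rw [h.1, show l + (N : ℤ) - 1 = (l - 1) + N by ring, h.1]

theorem dEa_zero (N : ℕ) {ε : ℝ} (hε : ε ≠ 0) {φ : ℝ → ℝ} (hφ : ContDiffOn ℝ 2 φ (Set.Ioi 0))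
    {F : ℝ} (hF : 0 < F) (v : ℤ → ℝ × ℝ) (hv : IsDisp N v) :
    dE (Ea N ε φ) (yLin ε F) v = 0 ∧ ∑ l ∈ Finset.Icc (1 : ℤ) (N : ℤ), (bd ε v l).1 = 0 := by
  have z : ∑ l ∈ Finset.Icc (1 : ℤ) (N : ℤ), (bd ε v l).1 = 0 := by
    unfold bd
    simp only [Prod.smul_fst, Prod.fst_sub, smul_eq_mul, ← Finset.mul_sum,
      Finset.sum_sub_distrib]
    have := sum_shift (fun l => (v (l - 1)).1) N
    simp only [add_sub_cancel_right] at this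
    have h0 : v (N : ℤ) = v 0 := by simpa using hv.1 0
    rw [this, h0]
    simp
  refine ⟨?_, z⟩
  rw [dEa_eq N hε hφ hF]
  simp only [Finset.sum_add_distrib, ← Finset.mul_sum, Prod.fst_add]
  have := sum_shift (fun l => (bd ε v l).1) N
  have h1 : bd ε v ((N : ℤ) + 1) = bd ε v 1 := by rw [add_comm]; exact bd_per hv 1
  simp only [h1] at this
  rw [this, z]
  simp

theorem dEQ_zero {N K : ℕ} (h : K + 2 < N) {ε : ℝ} (hε : ε ≠ 0) {φ : ℝ → ℝ}
    (hφ : ContDiffOn ℝ 2 φ (Set.Ioi 0))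
    {F : ℝ} (hF : 0 < F) (v : ℤ → ℝ × ℝ) (hv : IsDisp N v) :
    dE (EQNL N K ε φ) (yLin ε F) v = 0 := by
  have z := (dEa_zero N hε hφ hF v hv).2
  rw [dEQ_eq N K hε hφ hF]
  simp only [Finset.sum_add_distrib, ← Finset.mul_sum, Prod.fst_add]
  have t := sum_shift (fun l => (bd ε v l).1) K
  rw [t, z]
  rw [sum_split _ h, sum_split' _ h] at z
  linear_combination 2 * ε * deriv φ (2 * F) * z

theorem enorm2_sq (v : ℝ × ℝ) : enorm2 v ^ 2 = v.1 ^ 2 + v.2 ^ 2 := by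
  unfold enorm2; rw [Real.sq_sqrt (by positivity)]

theorem enorm2_nonneg (v : ℝ × ℝ) : 0 ≤ enorm2 v := Real.sqrt_nonneg _

theorem pt_bound (B1 B2 M : ℝ) (h1 : |B1| ≤ M) (h2 : |B2| ≤ M) (x y : ℝ × ℝ) :
    |B1 * (x.1 * y.1) + B2 * (x.2 * y.2)| ≤ M * (enorm2 x * enorm2 y) := by
  have hM : 0 ≤ M := (abs_nonneg _).trans h1
  have key : |x.1| * |y.1| + |x.2| * |y.2| ≤ enorm2 x * enorm2 y := by
    refine abs_le_of_sq_le_sq' ?_ (mul_nonneg (enorm2_nonneg _) (enorm2_nonneg _)) |>.2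
    rw [mul_pow, enorm2_sq, enorm2_sq, ← sq_abs x.1, ← sq_abs x.2, ← sq_abs y.1, ← sq_abs y.2]
    nlinarith [sq_nonneg (|x.1| * |y.2| - |x.2| * |y.1|)]
  calc |B1 * (x.1 * y.1) + B2 * (x.2 * y.2)|
      ≤ |B1| * (|x.1| * |y.1|) + |B2| * (|x.2| * |y.2|) := by
        refine (abs_add_le _ _).trans ?_
        simp only [abs_mul, le_refl]
    _ ≤ M * (|x.1| * |y.1|) + M * (|x.2| * |y.2|) := by gcongr
    _ = M * (|x.1| * |y.1| + |x.2| * |y.2|) := by ring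
    _ ≤ _ := by gcongr

theorem two_cs (a b c d : ℝ) : a * c + b * d ≤ √(a ^ 2 + b ^ 2) * √(c ^ 2 + d ^ 2) := by
  rw [← Real.sqrt_mul (by positivity)]
  apply Real.le_sqrt_of_sq_le
  nlinarith [sq_nonneg (a * d - b * c)]

theorem SQ_sub (N K : ℕ) (A B : ℝ) (p p' q : ℤ → ℝ) :
    SQ N K A B (fun l => p l - p' l) q = SQ N K A B p q - SQ N K A B p' q := by
  have h1 : ∀ S : Finset ℤ, ∑ l ∈ S, (p l - p' l) * q l
      = ∑ l ∈ S, p l * q l - ∑ l ∈ S, p' l * q l := fun S => by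
    rw [← Finset.sum_sub_distrib]; exact Finset.sum_congr rfl fun _ _ => by ring
  have h2 : ∀ S : Finset ℤ, ∑ l ∈ S, (p (l + 1) - p' (l + 1) + (p l - p' l)) * (q (l + 1) + q l)
      = ∑ l ∈ S, (p (l + 1) + p l) * (q (l + 1) + q l)
        - ∑ l ∈ S, (p' (l + 1) + p' l) * (q (l + 1) + q l) := fun S => by
    rw [← Finset.sum_sub_distrib]; exact Finset.sum_congr rfl fun _ _ => by ring
  unfold SQ
  simp only [← Finset.mul_sum, h1, h2]
  ring

theorem IsDisp.sub {N : ℕ} {u v : ℤ → ℝ × ℝ} (hu : IsDisp N u) (hv : IsDisp N v) :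
    IsDisp N (fun l => u l - v l) := by
  refine ⟨fun l => by simp only [hu.1, hv.1], ?_⟩
  rw [Finset.sum_sub_distrib, hu.2, hv.2, sub_zero]

theorem bd_sub (ε : ℝ) (u v : ℤ → ℝ × ℝ) (l : ℤ) :
    bd ε (fun l => u l - v l) l = bd ε u l - bd ε v l := by
  unfold bd
  rw [← smul_sub]; congr 1; exact sub_sub_sub_comm _ _ _ _

theorem bd_mul {ε : ℝ} (hε : ε ≠ 0) (u : ℤ → ℝ × ℝ) (l : ℤ) :
    u l - u (l - 1) = ε • bd ε u l := by
  unfold bd; rw [smul_smul, mul_inv_cancel₀ hε, one_smul]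

theorem bd3_mul {ε : ℝ} (hε : ε ≠ 0) (u : ℤ → ℝ × ℝ) (l : ℤ) :
    u (l + 1) - 2 • u l + u (l - 1) = ε ^ 2 • bd ε (bd ε u) (l + 1) := by
  have h1 := bd_mul hε (bd ε u) (l + 1)
  rw [add_sub_cancel_right] at h1
  rw [sq, mul_smul, ← h1, smul_sub, ← bd_mul hε, ← bd_mul hε, add_sub_cancel_right]
  rw [two_smul]; abel

theorem residual_bound {N K : ℕ} (hK1 : 1 < K) (hK2 : K + 2 < N) {ε : ℝ} (hε : 0 < ε) (B1 B2 M : ℝ)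
    (h1 : |B1| ≤ M) (h2 : |B2| ≤ M) (w q : ℤ → ℝ × ℝ) (z1 z2 : ℝ × ℝ) :
    B1 * (-∑ l ∈ Finset.Icc ((K : ℤ) + 2) (N : ℤ), ε ^ 2 * (w l).1 * (q l).1
        - ε * z2.1 * (q ((K : ℤ) + 1)).1 + ε * z1.1 * (q 1).1)
    + B2 * (-∑ l ∈ Finset.Icc ((K : ℤ) + 2) (N : ℤ), ε ^ 2 * (w l).2 * (q l).2
        - ε * z2.2 * (q ((K : ℤ) + 1)).2 + ε * z1.2 * (q 1).2)
    ≤ M * (ε * √(enorm2 z1 ^ 2 + enorm2 z2 ^ 2)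
        + ε ^ 2 * √(∑ l ∈ Finset.Icc ((K : ℤ) + 2) (N : ℤ), enorm2 (w l) ^ 2))
      * √(∑ l ∈ Finset.Icc (1 : ℤ) (N : ℤ), enorm2 (q l) ^ 2) := by
  have hM : 0 ≤ M := (abs_nonneg _).trans h1
  set T := √(∑ l ∈ Finset.Icc (1 : ℤ) (N : ℤ), enorm2 (q l) ^ 2) with hT
  have a1 := (le_abs_self _).trans (pt_bound B1 B2 M h1 h2 z1 (q 1))
  have a2 := (neg_le_abs _).trans (pt_bound B1 B2 M h1 h2 z2 (q ((K : ℤ) + 1)))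
  have a3 : -∑ l ∈ Finset.Icc ((K : ℤ) + 2) (N : ℤ),
      (B1 * ((w l).1 * (q l).1) + B2 * ((w l).2 * (q l).2))
      ≤ M * ∑ l ∈ Finset.Icc ((K : ℤ) + 2) (N : ℤ), enorm2 (w l) * enorm2 (q l) := by
    rw [← Finset.sum_neg_distrib, Finset.mul_sum]
    exact Finset.sum_le_sum fun l _ => (neg_le_abs _).trans (pt_bound B1 B2 M h1 h2 _ _)
  have b1 : enorm2 z1 * enorm2 (q 1) + enorm2 z2 * enorm2 (q ((K : ℤ) + 1))
      ≤ √(enorm2 z1 ^ 2 + enorm2 z2 ^ 2) * T := by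
    refine (two_cs _ _ _ _).trans ?_
    refine mul_le_mul_of_nonneg_left (Real.sqrt_le_sqrt ?_) (Real.sqrt_nonneg _)
    have hne : (1 : ℤ) ≠ (K : ℤ) + 1 := by omega
    rw [← Finset.sum_pair (f := fun l => enorm2 (q l) ^ 2) hne]
    refine Finset.sum_le_sum_of_subset_of_nonneg ?_ fun _ _ _ => sq_nonneg _
    intro x; simp; omega
  have b2 : ∑ l ∈ Finset.Icc ((K : ℤ) + 2) (N : ℤ), enorm2 (w l) * enorm2 (q l)
      ≤ √(∑ l ∈ Finset.Icc ((K : ℤ) + 2) (N : ℤ), enorm2 (w l) ^ 2) * T := by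
    refine (Real.sum_mul_le_sqrt_mul_sqrt _ _ _).trans ?_
    refine mul_le_mul_of_nonneg_left (Real.sqrt_le_sqrt ?_) (Real.sqrt_nonneg _)
    refine Finset.sum_le_sum_of_subset_of_nonneg ?_ fun _ _ _ => sq_nonneg _
    intro x; simp; omega
  rw [Finset.sum_add_distrib, ← Finset.mul_sum, ← Finset.mul_sum] at a3
  simp only [mul_assoc, ← Finset.mul_sum]
  have c1 := mul_le_mul_of_nonneg_left (add_le_add a1 a2) hε.le
  have c2 := mul_le_mul_of_nonneg_left a3 (sq_nonneg ε)
  have d1 := mul_le_mul_of_nonneg_left b1 (mul_nonneg hε.le hM)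
  have d2 := mul_le_mul_of_nonneg_left b2 (mul_nonneg (sq_nonneg ε) hM)
  linarith

theorem stmt_19 (N : ℕ) (hN : 4 ≤ N) (ε : ℝ) (hε : ε = (N : ℝ)⁻¹)
    (φ : ℝ → ℝ) (hφ : ContDiffOn ℝ 2 φ (Set.Ioi 0)) (F : ℝ) (hF : 0 < F)
    (K : ℕ) (hK1 : 1 < K) (hK2 : K + 2 < N)
    (hφ1 : 0 ≤ deriv φ (2 * F)) (hφ2 : deriv (deriv φ) (2 * F) ≤ 0)
    (hγ : 0 < min (deriv (deriv φ) F + 4 * deriv (deriv φ) (2 * F)) (deriv φ F / F))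
    (f ua uQNL : ℤ → ℝ × ℝ) (hf : IsDisp N f) (hua : IsDisp N ua)
    (huQNL : IsDisp N uQNL)
    (heqa : ∀ v : ℤ → ℝ × ℝ, IsDisp N v →
      dE (Ea N ε φ) (yLin ε F) v + d2E (Ea N ε φ) (yLin ε F) ua v = ip N ε f v)
    (heqQNL : ∀ v : ℤ → ℝ × ℝ, IsDisp N v →
      dE (EQNL N K ε φ) (yLin ε F) v + d2E (EQNL N K ε φ) (yLin ε F) uQNL v = ip N ε f v) :
    nrm N ε (bd ε (fun ℓ => ua ℓ - uQNL ℓ)) ≤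
      max |deriv (deriv φ) (2 * F)| |deriv φ (2 * F) / (2 * F)| /
        min (deriv (deriv φ) F + 4 * deriv (deriv φ) (2 * F)) (deriv φ F / F) *
      ε *
      (Real.sqrt (ε * (enorm2 (bd ε (bd ε ua) 1)) ^ 2
          + ε * (enorm2 (bd ε (bd ε ua) ((K : ℤ) + 2))) ^ 2)
        + ε * Real.sqrt (ε * ∑ ℓ ∈ Finset.Icc ((K : ℤ) + 2) (N : ℤ),
            (enorm2 (bd ε (bd ε (bd ε ua)) (ℓ + 1))) ^ 2)) := by
  have hNpos : (0 : ℝ) < N := by positivity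
  have hε0 : 0 < ε := by rw [hε]; positivity
  have hεne := hε0.ne'
  have he : IsDisp N (fun ℓ => ua ℓ - uQNL ℓ) := hua.sub huQNL
  have E1 := heqa _ he
  have E2 := heqQNL _ he
  rw [(dEa_zero N hεne hφ hF _ he).1, d2Ea_eq N hεne hφ hF] at E1
  rw [dEQ_zero hK2 hεne hφ hF _ he, d2EQ_eq N K hεne hφ hF, ← E1, zero_add, zero_add] at E2
  have E3 := mul_left_cancel₀ hεne E2
  clear E1 E2
  set q := bd ε (fun ℓ => ua ℓ - uQNL ℓ) with hq
  set p := bd ε ua with hp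
  have hqe : ∀ l, q l = p l - bd ε uQNL l := fun l => bd_sub ε ua uQNL l
  have hpp : ∀ l, p (l + (N : ℤ)) = p l := fun l => bd_per hua l
  have hqp : ∀ l, q (l + (N : ℤ)) = q l := fun l => bd_per he l
  set C1 := deriv (deriv φ) F
  set B1 := deriv (deriv φ) (2 * F)
  set C2 := deriv φ F / F
  set B2 := deriv φ (2 * F) / (2 * F) with hB2
  have hB2n : 0 ≤ B2 := by positivity
  set γ := min (C1 + 4 * B1) C2
  set M := max |B1| |B2|
  have s1 := SQ_sub N K C1 B1 (fun l => (p l).1) (fun l => (bd ε uQNL l).1) (fun l => (q l).1)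
  have s2 := SQ_sub N K C2 B2 (fun l => (p l).2) (fun l => (bd ε uQNL l).2) (fun l => (q l).2)
  have f1 : (fun l => (p l).1 - (bd ε uQNL l).1) = fun l => (q l).1 := by
    ext l; rw [hqe, Prod.fst_sub]
  have f2 : (fun l => (p l).2 - (bd ε uQNL l).2) = fun l => (q l).2 := by
    ext l; rw [hqe, Prod.snd_sub]
  rw [f1] at s1
  rw [f2] at s2
  have r1 := SQ_sub_Sa hK2 C1 B1 (fun l => (p l).1) (fun l => (q l).1)
    (fun l => by simp only [hpp]) (fun l => by simp only [hqp])
  have r2 := SQ_sub_Sa hK2 C2 B2 (fun l => (p l).2) (fun l => (q l).2)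
    (fun l => by simp only [hpp]) (fun l => by simp only [hqp])
  have l1 := SQ_lower hK2 C1 B1 hφ2 (fun l => (q l).1)
  have l2 := SQ_lower' (N := N) (K := K) C2 B2 hB2n (fun l => (q l).2)
  have R := residual_bound hK1 hK2 hε0 B1 B2 M (le_max_left _ _) (le_max_right _ _)
    (fun l => bd ε (bd ε p) (l + 1)) q (bd ε p 1) (bd ε p ((K : ℤ) + 2))
  have g3 : ∀ l, p (l + 1) - 2 • p l + p (l - 1) = ε ^ 2 • bd ε (bd ε p) (l + 1) := bd3_mul hεne p
  have g31 : ∀ l, (p (l + 1)).1 - 2 * (p l).1 + (p (l - 1)).1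
      = ε ^ 2 * (bd ε (bd ε p) (l + 1)).1 := fun l => by
    have := congrArg Prod.fst (g3 l); simpa using this
  have g32 : ∀ l, (p (l + 1)).2 - 2 * (p l).2 + (p (l - 1)).2
      = ε ^ 2 * (bd ε (bd ε p) (l + 1)).2 := fun l => by
    have := congrArg Prod.snd (g3 l); simpa using this
  have gK := bd_mul hεne p ((K : ℤ) + 2)
  rw [show (K : ℤ) + 2 - 1 = K + 1 by ring] at gK
  have g1 := bd_mul hεne p 1
  rw [show (1 : ℤ) - 1 = 0 by ring] at g1
  have gK1 : (p ((K : ℤ) + 2)).1 - (p ((K : ℤ) + 1)).1 = ε * (bd ε p ((K : ℤ) + 2)).1 := by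
    simpa using congrArg Prod.fst gK
  have gK2 : (p ((K : ℤ) + 2)).2 - (p ((K : ℤ) + 1)).2 = ε * (bd ε p ((K : ℤ) + 2)).2 := by
    simpa using congrArg Prod.snd gK
  have g11 : (p 1).1 - (p 0).1 = ε * (bd ε p 1).1 := by simpa using congrArg Prod.fst g1
  have g12 : (p 1).2 - (p 0).2 = ε * (bd ε p 1).2 := by simpa using congrArg Prod.snd g1
  simp only [g31, gK1, g11] at r1
  simp only [g32, gK2, g12] at r2
  rw [← r1, ← r2] at R
  set S := ∑ l ∈ Finset.Icc (1 : ℤ) (N : ℤ), enorm2 (q l) ^ 2 with hS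
  have hS0 : 0 ≤ S := Finset.sum_nonneg fun _ _ => sq_nonneg _
  have hSs : S = ∑ l ∈ Finset.Icc (1 : ℤ) (N : ℤ), (q l).1 ^ 2
      + ∑ l ∈ Finset.Icc (1 : ℤ) (N : ℤ), (q l).2 ^ 2 := by
    rw [hS, ← Finset.sum_add_distrib]; exact Finset.sum_congr rfl fun _ _ => enorm2_sq _
  have low : γ * S ≤ SQ N K C1 B1 (fun l => (q l).1) (fun l => (q l).1)
      + SQ N K C2 B2 (fun l => (q l).2) (fun l => (q l).2) := by
    rw [hSs, mul_add]
    refine add_le_add (le_trans ?_ l1) (le_trans ?_ l2)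
    · exact mul_le_mul_of_nonneg_right (min_le_left _ _) (Finset.sum_nonneg fun _ _ => sq_nonneg _)
    · exact mul_le_mul_of_nonneg_right (min_le_right _ _) (Finset.sum_nonneg fun _ _ => sq_nonneg _)
  set Z := enorm2 (bd ε p 1) ^ 2 + enorm2 (bd ε p ((K : ℤ) + 2)) ^ 2 with hZ
  set W := ∑ l ∈ Finset.Icc ((K : ℤ) + 2) (N : ℤ), enorm2 (bd ε (bd ε p) (l + 1)) ^ 2 with hW
  have hM0 : 0 ≤ M := (abs_nonneg _).trans (le_max_left _ _)
  have main : γ * S ≤ M * (ε * √Z + ε ^ 2 * √W) * √S := by linarith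
  have main2 : √S ≤ M * (ε * √Z + ε ^ 2 * √W) / γ := by
    rcases hS0.eq_or_lt with h0 | h0
    · rw [← h0, Real.sqrt_zero]; positivity
    · rw [le_div_iff₀ hγ]
      have hsp : 0 < √S := Real.sqrt_pos.2 h0
      refine le_of_mul_le_mul_right ?_ hsp
      have := Real.mul_self_sqrt hS0
      calc √S * γ * √S = γ * (√S * √S) := by ring
        _ = γ * S := by rw [this]
        _ ≤ _ := main
  have fin1 : nrm N ε q = √ε * √S := by
    unfold nrm; rw [Real.sqrt_mul hε0.le]
  rw [fin1, ← mul_add, ← hZ, Real.sqrt_mul hε0.le, Real.sqrt_mul hε0.le]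
  calc √ε * √S ≤ √ε * (M * (ε * √Z + ε ^ 2 * √W) / γ) := by gcongr
    _ = _ := by ring
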